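/- arXiv:1009.1217 — 2 statements merged into one kernel-verified Lean document; each statement's English description precedes it below -/
import Mathlib

section
/- Let β ∈ (1/2, 1) and let ρ(m) = Σ_{i=1}^∞ i^{-β} (i+m)^{-β} for integers m ≥ 0. Then ρ(m) is asymptotically equivalent to c_β · m^{-2β+1} as m → ∞, i.e. lim_{m→∞} ρ(m) / m^{1-2β} = c_β. -/
open Filter Topology

/-- For `β ∈ (1/2, 1)`, `ρ β m = ∑_{i=1}^∞ i^{-β} (i+m)^{-β}`. -/
noncomputable def rho (β : ℝ) (m : ℕ) : ℝ :=
  ∑' i : ℕ, ((i : ℝ) + 1) ^ (-β) * (((i : ℝ) + 1 + (m : ℝ)) ^ (-β))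

/-- `c_β = ∫_0^∞ y^{-β} (1+y)^{-β} dy`. -/
noncomputable def cBeta (β : ℝ) : ℝ :=
  ∫ y in Set.Ioi (0 : ℝ), y ^ (-β) * (1 + y) ^ (-β)

open MeasureTheory in
/-- Right-endpoint Riemann sums of a nonnegative, antitone, integrable function on `(0, ∞)`
converge to its integral, even if the function is unbounded near `0`. -/
theorem tendsto_riemannSum_of_antitoneOn {f : ℝ → ℝ} (hf : AntitoneOn f (Set.Ioi 0))
    (hf0 : ∀ x ∈ Set.Ioi (0 : ℝ), 0 ≤ f x) (hfi : IntegrableOn f (Set.Ioi 0)) :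
    Tendsto (fun m : ℕ => ∑' i : ℕ, (1 / (m : ℝ)) * f (((i : ℝ) + 1) / m)) atTop
      (𝓝 (∫ y in Set.Ioi (0 : ℝ), f y)) := by
  have hii : ∀ {a b : ℝ}, 0 ≤ a → a ≤ b → IntervalIntegrable f volume a b := fun ha hab =>
    (intervalIntegrable_iff_integrableOn_Ioc_of_le hab).2
      (hfi.mono_set fun x hx => lt_of_le_of_lt ha hx.1)
  have hlim : Tendsto (fun m : ℕ => ∫ y in (0 : ℝ)..1 / m, f y) atTop (𝓝 0) := by
    have hc : ContinuousOn (fun x => ∫ t in (0 : ℝ)..x, f t) (Set.uIcc 0 1) := by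
      apply intervalIntegral.continuousOn_primitive_interval
      rw [Set.uIcc_of_le zero_le_one, integrableOn_Icc_iff_integrableOn_Ioc]
      exact hfi.mono_set fun x hx => hx.1
    have h0 := hc 0 (by simp)
    have h1 : Tendsto (fun m : ℕ => 1 / (m : ℝ)) atTop (𝓝[Set.uIcc 0 1] 0) := by
      refine tendsto_nhdsWithin_iff.2 ⟨tendsto_one_div_atTop_nhds_zero_nat, ?_⟩
      filter_upwards [eventually_ge_atTop 1] with m hm
      rw [Set.uIcc_of_le zero_le_one]
      have : (1 : ℝ) ≤ m := by exact_mod_cast hm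
      exact ⟨by positivity, by rw [div_le_one (by positivity)]; exact this⟩
    simpa [Function.comp_def] using h0.tendsto.comp h1
  have key : ∀ m : ℕ, 1 ≤ m →
      (∫ y in Set.Ioi (0 : ℝ), f y) - ∫ y in (0 : ℝ)..1 / m, f y
        ≤ ∑' i : ℕ, (1 / (m : ℝ)) * f (((i : ℝ) + 1) / m) ∧
      ∑' i : ℕ, (1 / (m : ℝ)) * f (((i : ℝ) + 1) / m) ≤ ∫ y in Set.Ioi (0 : ℝ), f y := by
    intro m hm
    have hm0 : (0 : ℝ) < m := by exact_mod_cast hm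
    have hle : ∀ i : ℕ, (i : ℝ) / m ≤ ((i : ℝ) + 1) / m := fun i => by gcongr; linarith
    have hlen : ∀ i : ℕ, ((i : ℝ) + 1) / m - (i : ℝ) / m = 1 / m := fun i => by ring
    set g : ℕ → ℝ := fun i => ∫ y in (i : ℝ) / m..((i : ℝ) + 1) / m, f y with hg
    have hg0 : ∀ i, 0 ≤ g i := fun i =>
      intervalIntegral.integral_nonneg_of_ae_restrict (hle i) (by
        rw [Filter.EventuallyLE, ae_restrict_congr_set Ioc_ae_eq_Icc.symm]
        filter_upwards [ae_restrict_mem measurableSet_Ioc] with x hx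
        exact hf0 x (lt_of_le_of_lt (by positivity) hx.1))
    have hgs : HasSum g (∫ y in Set.Ioi (0 : ℝ), f y) := by
      rw [hasSum_iff_tendsto_nat_of_nonneg hg0]
      have hs : ∀ n : ℕ, ∑ i ∈ Finset.range n, g i = ∫ y in (0 : ℝ)..(n : ℝ) / m, f y := by
        intro n
        have := intervalIntegral.sum_integral_adjacent_intervals (f := f) (μ := volume)
          (a := fun i : ℕ => (i : ℝ) / m) (n := n)
          (fun i _ => hii (by positivity) (by simpa using hle i))
        simpa [hg] using this
      simp_rw [hs]
      exact intervalIntegral_tendsto_integral_Ioi 0 hfi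
        (tendsto_natCast_atTop_atTop.atTop_div_const hm0)
    have hup : ∀ i : ℕ, (1 / (m : ℝ)) * f (((i : ℝ) + 1) / m) ≤ g i := by
      intro i
      have h := intervalIntegral.integral_mono_on_of_le_Ioo (μ := volume) (hle i)
        (f := fun _ => f (((i : ℝ) + 1) / m)) (g := f) (by simp)
        (hii (by positivity) (hle i)) (fun x hx => by
          have hx0 : (0 : ℝ) < x := lt_of_le_of_lt (by positivity) hx.1
          exact hf hx0 (hx0.trans hx.2) hx.2.le)
      rwa [intervalIntegral.integral_const, hlen, smul_eq_mul] at h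
    have hlo : ∀ i : ℕ, g (i + 1) ≤ (1 / (m : ℝ)) * f (((i : ℝ) + 1) / m) := by
      intro i
      have h := intervalIntegral.integral_mono_on_of_le_Ioo (μ := volume) (hle (i + 1))
        (g := fun _ => f (((i : ℝ) + 1) / m)) (f := f)
        (hii (by positivity) (hle (i + 1))) (by simp) (fun x hx => by
          have hx1 : ((i : ℝ) + 1) / m < x := by simpa using hx.1
          have hi : (0 : ℝ) < ((i : ℝ) + 1) / m := by positivity
          exact hf hi (hi.trans hx1) hx1.le)
      rwa [intervalIntegral.integral_const, hlen, smul_eq_mul] at h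
    have hsum : Summable fun i : ℕ => (1 / (m : ℝ)) * f (((i : ℝ) + 1) / m) :=
      hgs.summable.of_nonneg_of_le
        (fun i => mul_nonneg (by positivity) (hf0 _ (Set.mem_Ioi.2 (by positivity)))) hup
    constructor
    · have h1 := hgs.summable.tsum_eq_zero_add
      have h2 := ((summable_nat_add_iff 1).2 hgs.summable).tsum_le_tsum hlo hsum
      rw [hgs.tsum_eq] at h1
      have h3 : g 0 = ∫ y in (0 : ℝ)..1 / m, f y := by simp [hg]
      rw [h1, h3]
      linarith
    · rw [← hgs.tsum_eq]
      exact hsum.tsum_le_tsum hup hgs.summable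
  refine tendsto_of_tendsto_of_tendsto_of_le_of_le' (by simpa using hlim.const_sub _)
    tendsto_const_nhds ?_ ?_
  · filter_upwards [eventually_ge_atTop 1] with m hm using by simpa only [one_div] using (key m hm).1
  · filter_upwards [eventually_ge_atTop 1] with m hm using (key m hm).2

open MeasureTheory in
theorem integrableOn_rpow_neg_mul_one_add_rpow_neg {β : ℝ} (hβ : 1 / 2 < β) (hβ1 : β < 1) :
    IntegrableOn (fun y : ℝ => y ^ (-β) * (1 + y) ^ (-β)) (Set.Ioi 0) := by
  have hmeas : Measurable fun y : ℝ => y ^ (-β) * (1 + y) ^ (-β) := by fun_prop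
  rw [← Set.Ioc_union_Ioi_eq_Ioi (zero_le_one (α := ℝ))]
  refine IntegrableOn.union ?_ ?_
  · have h : IntegrableOn (fun y : ℝ => y ^ (-β)) (Set.Ioc 0 1) :=
      (intervalIntegrable_iff_integrableOn_Ioc_of_le zero_le_one).1
        (intervalIntegral.intervalIntegrable_rpow' (by linarith))
    refine Integrable.mono' h hmeas.aestronglyMeasurable ?_
    filter_upwards [ae_restrict_mem measurableSet_Ioc] with y hy
    have hy0 : 0 < y := hy.1
    rw [Real.norm_of_nonneg (by positivity)]
    exact mul_le_of_le_one_right (by positivity)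
      (Real.rpow_le_one_of_one_le_of_nonpos (by linarith) (by linarith))
  · have h : IntegrableOn (fun y : ℝ => y ^ (-(2 * β))) (Set.Ioi 1) :=
      integrableOn_Ioi_rpow_of_lt (by linarith) zero_lt_one
    refine Integrable.mono' h hmeas.aestronglyMeasurable ?_
    filter_upwards [ae_restrict_mem measurableSet_Ioi] with y hy
    have hy0 : 0 < y := zero_lt_one.trans hy
    rw [Real.norm_of_nonneg (by positivity), show -(2 * β) = -β + -β by ring,
      Real.rpow_add hy0]
    exact mul_le_mul_of_nonneg_left
      (Real.rpow_le_rpow_of_nonpos hy0 (by linarith) (by linarith)) (by positivity)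

theorem rho_div_rpow_eq_riemannSum (β : ℝ) {m : ℕ} (hm : 0 < m) :
    rho β m / (m : ℝ) ^ (1 - 2 * β) =
      ∑' i : ℕ, (1 / (m : ℝ)) *
        ((((i : ℝ) + 1) / m) ^ (-β) * (1 + ((i : ℝ) + 1) / m) ^ (-β)) := by
  have hm0 : (0 : ℝ) < m := by exact_mod_cast hm
  rw [rho, ← tsum_div_const]
  refine tsum_congr fun i => ?_
  rw [show 1 + ((i : ℝ) + 1) / m = ((i : ℝ) + 1 + m) / m by field_simp; ring,
    Real.div_rpow (by positivity) hm0.le, Real.div_rpow (by positivity) hm0.le,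
    show 1 - 2 * β = 1 + (-β + -β) by ring, Real.rpow_add hm0, Real.rpow_add hm0, Real.rpow_one]
  field_simp

theorem stmt_0 (β : ℝ) (hβ : 1 / 2 < β) (hβ1 : β < 1) :
    Tendsto (fun m : ℕ => rho β m / (m : ℝ) ^ (1 - 2 * β)) atTop (𝓝 (cBeta β)) := by
  have hanti : AntitoneOn (fun y : ℝ => y ^ (-β) * (1 + y) ^ (-β)) (Set.Ioi 0) := by
    intro x hx y hy hxy
    have hx0 : 0 < x := hx
    have hy0 : 0 < y := hy
    exact mul_le_mul (Real.rpow_le_rpow_of_nonpos hx0 hxy (by linarith))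
      (Real.rpow_le_rpow_of_nonpos (by linarith) (by linarith) (by linarith))
      (by positivity) (by positivity)
  refine (tendsto_riemannSum_of_antitoneOn hanti (fun x hx => ?_)
    (integrableOn_rpow_neg_mul_one_add_rpow_neg hβ hβ1)).congr' ?_
  · have hx0 : 0 < x := hx
    positivity
  · filter_upwards [eventually_gt_atTop 0] with m hm
    exact (rho_div_rpow_eq_riemannSum β hm).symm
end

section
/- Let β ∈ (1/2, 1) and let q ≥ 1 be an integer with q (2β − 1) > 1. Then the series Σ_{m=1}^∞ ρ(m)^q converges, where ρ(m) = Σ_{i=1}^∞ i^{-β}(i+m)^{-β}. -/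
theorem rho_nonneg (β : ℝ) (m : ℕ) : 0 ≤ rho β m :=
  tsum_nonneg fun _ => by positivity

theorem summable_nat_add_one_rpow {p : ℝ} (hp : p < -1) :
    Summable fun i : ℕ => ((i : ℝ) + 1) ^ p := by
  simpa using (summable_nat_add_iff 1).2 (Real.summable_nat_rpow.2 hp)

/-- For `0 ≤ s ≤ β`, part of the decay of the second factor can be moved to `m`. -/
theorem rho_summand_le {β s : ℝ} (hs : 0 ≤ s) (hsβ : s ≤ β) (m i : ℕ) :
    ((i : ℝ) + 1) ^ (-β) * ((i : ℝ) + 1 + ((m + 1 : ℕ) : ℝ)) ^ (-β) ≤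
      ((m : ℝ) + 1) ^ (-s) * ((i : ℝ) + 1) ^ (s - 2 * β) := by
  have hi : (0 : ℝ) < (i : ℝ) + 1 := by positivity
  have hm : (0 : ℝ) < (m : ℝ) + 1 := by positivity
  push_cast
  have hsplit : ((i : ℝ) + 1 + ((m : ℝ) + 1)) ^ (-β) =
      ((i : ℝ) + 1 + ((m : ℝ) + 1)) ^ (-s) * ((i : ℝ) + 1 + ((m : ℝ) + 1)) ^ (s - β) := by
    rw [← Real.rpow_add (by positivity)]
    ring_nf
  have hleft : ((i : ℝ) + 1 + ((m : ℝ) + 1)) ^ (-s) ≤ ((m : ℝ) + 1) ^ (-s) :=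
    Real.rpow_le_rpow_of_nonpos hm (by linarith) (by linarith)
  have hright : ((i : ℝ) + 1 + ((m : ℝ) + 1)) ^ (s - β) ≤ ((i : ℝ) + 1) ^ (s - β) :=
    Real.rpow_le_rpow_of_nonpos hi (by linarith) (by linarith)
  calc ((i : ℝ) + 1) ^ (-β) * ((i : ℝ) + 1 + ((m : ℝ) + 1)) ^ (-β)
      ≤ ((i : ℝ) + 1) ^ (-β) * (((m : ℝ) + 1) ^ (-s) * ((i : ℝ) + 1) ^ (s - β)) := by
        rw [hsplit]
        gcongr
    _ = ((m : ℝ) + 1) ^ (-s) * (((i : ℝ) + 1) ^ (-β) * ((i : ℝ) + 1) ^ (s - β)) := by ring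
    _ = ((m : ℝ) + 1) ^ (-s) * ((i : ℝ) + 1) ^ (s - 2 * β) := by
        rw [← Real.rpow_add hi]
        ring_nf

theorem rho_succ_le {β s : ℝ} (hs : 0 ≤ s) (hsβ : s ≤ β) (hs1 : s < 2 * β - 1) (m : ℕ) :
    rho β (m + 1) ≤ ((m : ℝ) + 1) ^ (-s) * ∑' i : ℕ, ((i : ℝ) + 1) ^ (s - 2 * β) := by
  have hsum : Summable fun i : ℕ => ((m : ℝ) + 1) ^ (-s) * ((i : ℝ) + 1) ^ (s - 2 * β) :=
    (summable_nat_add_one_rpow (by linarith)).mul_left _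
  rw [← tsum_mul_left]
  exact Summable.tsum_le_tsum (rho_summand_le hs hsβ m)
    (hsum.of_nonneg_of_le (fun _ => by positivity) (rho_summand_le hs hsβ m)) hsum

theorem stmt_8 (β : ℝ) (hβ : 1 / 2 < β) (hβ1 : β < 1) (q : ℕ) (hq : 1 ≤ q)
    (hqβ : 1 < (q : ℝ) * (2 * β - 1)) :
    Summable fun m : ℕ => (rho β (m + 1)) ^ q := by
  have hq0 : (0 : ℝ) < q := by exact_mod_cast hq
  obtain ⟨s, hqs, hs1⟩ : ∃ s : ℝ, 1 / (q : ℝ) < s ∧ s < 2 * β - 1 :=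
    exists_between ((div_lt_iff₀' hq0).2 hqβ)
  have hs : 0 ≤ s := (one_div_pos.2 hq0).le.trans hqs.le
  have hqs' : 1 < (q : ℝ) * s := (div_lt_iff₀' hq0).1 hqs
  refine Summable.of_nonneg_of_le (fun m => pow_nonneg (rho_nonneg β _) q)
    (fun m => pow_le_pow_left₀ (rho_nonneg β _) (rho_succ_le hs (by linarith) hs1 m) q) ?_
  simp_rw [mul_pow]
  refine Summable.mul_right _ ?_
  refine (summable_nat_add_one_rpow (p := -s * q) (by linarith)).congr fun m => ?_
  rw [Real.rpow_mul_natCast (by positivity)]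
end
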